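/- arXiv:2505.23972 — 3 statements merged into one kernel-verified Lean document; each statement's English description precedes it below -/
import Mathlib

section
/- Let n ∈ ℕ, α > 1, and let f ∈ SR_α be convex, nondecreasing, with ∫_{ℝⁿ} exp(−f(‖z‖)) dz = 1. Let κ > 0, c ∈ (1−α/2, 1) and γ ∈ (0, 2c+α−2). Then there exists K > 0 such that for every integer m ≥ 2, every z ∈ ℝⁿ with ‖z‖/m ≥ K, and every measurable h : ℝⁿ → ℝ satisfying |h(y + z/m)| ≤ ‖y‖^κ for all y with ‖y‖ ≥ (‖z‖/m)^c, one has: | ∫_{(ℝⁿ)^{m−1}} h(y₁)·1{‖y₁ − z/m‖ ≥ (‖z‖/m)^c}·exp( −Σ_{i=1}^{m−1} f(‖y_i‖) − f(‖z − Σ_{i=1}^{m−1} y_i‖) ) dy₁…dy_{m−1} | ≤ exp(−(‖z‖/m)^γ) · ∫_{(ℝⁿ)^{m−1}} exp( −Σ_{i=1}^{m−1} f(‖y_i‖) − f(‖z − Σ_{i=1}^{m−1} y_i‖) ) dy₁…dy_{m−1}. -/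
open MeasureTheory Filter Real Set
open scoped Topology BigOperators ENNReal RealInnerProductSpace

noncomputable section

/-- `f` is smoothly regularly varying of index `α`: beyond some `z₀ ≥ 1` it is positive and
infinitely differentiable, and `h u = log (f (exp u))` satisfies `h' → α` and
`h^(m) → 0` for every `m ≥ 2`. -/
def SmoothRegVary (α : ℝ) (f : ℝ → ℝ) : Prop :=
  ∃ z₀ : ℝ, 1 ≤ z₀ ∧ (∀ x, z₀ < x → 0 < f x) ∧
    ContDiffOn ℝ (⊤ : ℕ∞) f (Set.Ioi z₀) ∧
    Filter.Tendsto (deriv (fun u => Real.log (f (Real.exp u)))) Filter.atTop (nhds α) ∧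
    ∀ m : ℕ, 2 ≤ m →
      Filter.Tendsto (iteratedDeriv m (fun u => Real.log (f (Real.exp u))))
        Filter.atTop (nhds 0)

/-- `convPow n p m` is the `(m+1)`-fold convolution power of the density `p` on `ℝⁿ`;
so `convPow n p 0 = p` and `convPow n p (m+1) = (convPow n p m) ⋆ p`. -/
def convPow (n : ℕ) (p : EuclideanSpace ℝ (Fin n) → ℝ) : ℕ → EuclideanSpace ℝ (Fin n) → ℝ
  | 0 => p
  | m + 1 => fun x => ∫ y, convPow n p m (x - y) * p y

/-- `cpDensity n f t x = Σ_{m≥1} e^{-t} tᵐ/m! · p_m(x)`, the density (away from 0) of the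
time-`t` marginal of the compound Poisson process with jump density `exp (-f ‖z‖)`. -/
def cpDensity (n : ℕ) (f : ℝ → ℝ) (t : ℝ) (x : EuclideanSpace ℝ (Fin n)) : ℝ :=
  ∑' m : ℕ, Real.exp (-t) * t ^ (m + 1) / (Nat.factorial (m + 1) : ℝ) *
    convPow n (fun z => Real.exp (-f ‖z‖)) m x

lemma SmoothRegVary.exists_rpow_le {α β : ℝ} (hα : 1 < α) (hβα : β < α) {f : ℝ → ℝ}
    (hf : SmoothRegVary α f) :
    ∃ C > (0 : ℝ), ∃ x₀ ≥ (1 : ℝ), ∃ f₁ f₂ : ℝ → ℝ, ∀ x ≥ x₀,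
      C * x ^ β ≤ f x ∧ HasDerivAt f (f₁ x) x ∧ HasDerivAt f₁ (f₂ x) x ∧
        C * x ^ (β - 2) ≤ f₂ x := by
  obtain ⟨z₀, hz₀, hpos, hsm, hd1, hd2⟩ := hf
  set H : ℝ → ℝ := fun u => Real.log (f (Real.exp u)) with hH
  have hd2 := hd2 2 le_rfl
  have hz₀' : 0 < z₀ := by linarith
  have hexp : ∀ u ∈ Ioi (Real.log z₀), z₀ < Real.exp u := fun u hu =>
    (Real.log_lt_iff_lt_exp hz₀').1 hu
  have hHsm : ContDiffOn ℝ (⊤ : ℕ∞) H (Ioi (Real.log z₀)) := by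
    refine ContDiffOn.log ?_ fun u hu => (hpos _ (hexp u hu)).ne'
    exact hsm.comp Real.contDiff_exp.contDiffOn fun u hu => hexp u hu
  have hH' : ContDiffOn ℝ (⊤ : ℕ∞) (deriv H) (Ioi (Real.log z₀)) :=
    hHsm.deriv_of_isOpen isOpen_Ioi (by norm_cast)
  have hderH : ∀ u ∈ Ioi (Real.log z₀), HasDerivAt H (deriv H u) u := fun u hu =>
    (((hHsm.differentiableOn (by simp)) u hu).differentiableAt (Ioi_mem_nhds hu)).hasDerivAt
  have hderH' : ∀ u ∈ Ioi (Real.log z₀), HasDerivAt (deriv H) (iteratedDeriv 2 H u) u := by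
    intro u hu
    have := (((hH'.differentiableOn (by simp)) u hu).differentiableAt
      (Ioi_mem_nhds hu)).hasDerivAt
    rwa [iteratedDeriv_succ, iteratedDeriv_one]
  set c₀ : ℝ := α * (α - 1) / 2 with hc₀
  have hc₀pos : 0 < c₀ := by
    have : 0 < α - 1 := by linarith
    positivity
  have hlim : Tendsto (fun u => deriv H u ^ 2 - deriv H u + iteratedDeriv 2 H u) atTop
      (𝓝 (α ^ 2 - α + 0)) := ((hd1.pow 2).sub hd1).add hd2
  have hev : ∀ᶠ u in atTop, β ≤ deriv H u ∧
      c₀ ≤ deriv H u ^ 2 - deriv H u + iteratedDeriv 2 H u :=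
    ((hd1.eventually_const_lt hβα).mono fun _ h => h.le).and
      ((hlim.eventually_const_lt (by nlinarith)).mono fun _ h => h.le)
  obtain ⟨u₀, hu₀⟩ := eventually_atTop.1 hev
  set u₁ := max u₀ (Real.log z₀ + 1) with hu₁
  have hu₁z : Real.log z₀ < u₁ := lt_of_lt_of_le (by linarith) (le_max_right _ _)
  have hu₁0 : 0 ≤ u₁ := le_trans (by have := Real.log_nonneg hz₀; linarith) (le_max_right _ _)
  set A : ℝ := Real.exp (H u₁ - β * u₁) with hA
  have hfx : ∀ x, z₀ < x → f x = Real.exp (H (Real.log x)) := by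
    intro x hx
    rw [hH]
    simp only
    rw [Real.exp_log (hz₀'.trans hx), Real.exp_log (hpos x hx)]
  have key : ∀ x ≥ Real.exp u₁, 0 < x ∧ z₀ < x ∧ u₁ ≤ Real.log x := by
    intro x hx
    have hx0 : 0 < x := (Real.exp_pos _).trans_le hx
    exact ⟨hx0, (hexp _ hu₁z).trans_le hx, (Real.le_log_iff_exp_le hx0).2 hx⟩
  have hpow : ∀ x ≥ Real.exp u₁, A * x ^ β ≤ f x := by
    intro x hx
    obtain ⟨hx0, hxz, hux⟩ := key x hx
    have hmv := Convex.mul_sub_le_image_sub_of_le_deriv (convex_Ici u₁) (f := H) (C := β)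
      (fun u hu => (hderH u (hu₁z.trans_le hu)).continuousAt.continuousWithinAt)
      (fun u hu => (hderH u (hu₁z.trans_le (interior_subset hu))).differentiableAt.differentiableWithinAt)
      (fun u hu => (hu₀ u ((le_max_left _ _).trans (interior_subset hu))).1)
      u₁ self_mem_Ici (Real.log x) hux hux
    rw [hfx x hxz, Real.rpow_def_of_pos hx0, hA, ← Real.exp_add]
    apply Real.exp_le_exp.2
    nlinarith
  refine ⟨min A (A * c₀), lt_min (Real.exp_pos _) (mul_pos (Real.exp_pos _) hc₀pos),
    Real.exp u₁, Real.one_le_exp hu₁0, fun x => f x * deriv H (Real.log x) / x,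
    fun x => f x * (deriv H (Real.log x) ^ 2 - deriv H (Real.log x)
      + iteratedDeriv 2 H (Real.log x)) / x ^ 2, ?_⟩
  intro x hx
  obtain ⟨hx0, hxz, hux⟩ := key x hx
  have hlx : Real.log z₀ < Real.log x := hu₁z.trans_le hux
  have hfd : HasDerivAt f (f x * deriv H (Real.log x) / x) x := by
    have h1 : HasDerivAt (fun x => Real.exp (H (Real.log x)))
        (Real.exp (H (Real.log x)) * (deriv H (Real.log x) * x⁻¹)) x :=
      ((hderH _ hlx).comp x (Real.hasDerivAt_log hx0.ne')).exp
    rw [← hfx x hxz] at h1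
    refine (h1.congr_of_eventuallyEq ?_).congr_deriv (by rw [div_eq_mul_inv, mul_assoc])
    filter_upwards [Ioi_mem_nhds hxz] with y hy using hfx y hy
  refine ⟨?_, hfd, ?_, ?_⟩
  · refine le_trans ?_ (hpow x hx)
    gcongr
    exact min_le_left _ _
  · have h2 := (hfd.mul ((hderH' _ hlx).comp x (Real.hasDerivAt_log hx0.ne'))).div
      (hasDerivAt_id x) hx0.ne'
    refine h2.congr_deriv ?_
    simp only [id, Function.comp, Pi.mul_apply]
    field_simp
    ring
  · have hq := (hu₀ _ ((le_max_left _ _).trans hux)).2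
    have h3 := hpow x hx
    rw [Real.rpow_sub hx0, Real.rpow_two, le_div_iff₀ (by positivity)]
    have h4 : x ^ β / x ^ 2 * x ^ 2 = x ^ β := by field_simp
    rw [mul_assoc, h4]
    calc min A (A * c₀) * x ^ β ≤ (A * c₀) * x ^ β := by
          gcongr
          exact min_le_right _ _
      _ = (A * x ^ β) * c₀ := by ring
      _ ≤ f x * _ := by
          apply mul_le_mul h3 hq hc₀pos.le
          exact (hpos x hxz).le

lemma quadratic_le_of_second_deriv_ge {f f₁ f₂ : ℝ → ℝ} {b p k : ℝ} (hbp : b ≤ p)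
    (h1 : ∀ x ∈ Icc b p, HasDerivAt f (f₁ x) x) (h2 : ∀ x ∈ Icc b p, HasDerivAt f₁ (f₂ x) x)
    (hk : ∀ x ∈ Icc b p, k ≤ f₂ x) :
    f b + f₁ b * (p - b) + k / 2 * (p - b) ^ 2 ≤ f p := by
  have hmono1 : MonotoneOn (fun x => f₁ x - k * x) (Icc b p) := by
    have hd : ∀ x ∈ Icc b p, HasDerivAt (fun x => f₁ x - k * x) (f₂ x - k) x := fun x hx => by
      exact ((h2 x hx).fun_sub ((hasDerivAt_id x).const_mul k)).congr_deriv (by simp)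
    refine monotoneOn_of_deriv_nonneg (convex_Icc b p)
      (fun x hx => (hd x hx).continuousAt.continuousWithinAt)
      (fun x hx => (hd x (interior_subset hx)).differentiableAt.differentiableWithinAt) ?_
    intro x hx
    rw [(hd x (interior_subset hx)).deriv]
    exact sub_nonneg.2 (hk x (interior_subset hx))
  have hmono2 : MonotoneOn (fun x => f x - f₁ b * x - k / 2 * (x - b) ^ 2) (Icc b p) := by
    have hd : ∀ x ∈ Icc b p, HasDerivAt (fun x => f x - f₁ b * x - k / 2 * (x - b) ^ 2)
        (f₁ x - f₁ b - k * (x - b)) x := fun x hx => by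
      refine (((h1 x hx).fun_sub ((hasDerivAt_id x).const_mul (f₁ b))).fun_sub
        ((((hasDerivAt_id x).sub_const b).fun_pow 2).const_mul (k / 2))).congr_deriv ?_
      simp
      ring
    refine monotoneOn_of_deriv_nonneg (convex_Icc b p)
      (fun x hx => (hd x hx).continuousAt.continuousWithinAt)
      (fun x hx => (hd x (interior_subset hx)).differentiableAt.differentiableWithinAt) ?_
    intro x hx
    have hx := interior_subset hx
    rw [(hd x hx).deriv]
    have := hmono1 (left_mem_Icc.2 hbp) hx hx.1
    simp only at this
    linarith
  have := hmono2 (left_mem_Icc.2 hbp) (right_mem_Icc.2 hbp) hbp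
  simp only [sub_self] at this
  linarith

/-- The midpoint convexity gap of `F` at the pair `x`, `y`. -/
def convexGap {E : Type*} [AddCommGroup E] [Module ℝ E] (F : E → ℝ) (x y : E) : ℝ :=
  F x + F y - 2 * F ((1 / 2 : ℝ) • (x + y))

lemma convexGap_comm {E : Type*} [AddCommGroup E] [Module ℝ E] (F : E → ℝ) (x y : E) :
    convexGap F x y = convexGap F y x := by
  simp only [convexGap, add_comm x y, add_comm (F x)]

lemma rpow_mul_le_of_mem_Icc {β b M L : ℝ} (hL : 1 ≤ L) (hM : 0 < M) (h1 : M / L ≤ b)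
    (h2 : b ≤ L * M) : L ^ (-|β|) * M ^ β ≤ b ^ β := by
  have hL0 : 0 < L := by linarith
  have hb : 0 < b := lt_of_lt_of_le (by positivity) h1
  rcases le_total 0 β with h | h
  · rw [abs_of_nonneg h]
    calc L ^ (-β) * M ^ β = (M / L) ^ β := by
          rw [Real.div_rpow hM.le hL0.le, Real.rpow_neg hL0.le]; field_simp
      _ ≤ b ^ β := Real.rpow_le_rpow (by positivity) h1 h
  · rw [abs_of_nonpos h, neg_neg, ← Real.mul_rpow hL0.le hM.le]
    exact Real.rpow_le_rpow_of_nonpos hb h2 h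

lemma exists_radial_gap {β : ℝ} {f f₁ f₂ : ℝ → ℝ} {C x₀ : ℝ} (hC : 0 < C) (hx₀ : 1 ≤ x₀)
    (hconv : ConvexOn ℝ (Ici (0 : ℝ)) f)
    (h1 : ∀ x ≥ x₀, HasDerivAt f (f₁ x) x) (h2 : ∀ x ≥ x₀, HasDerivAt f₁ (f₂ x) x)
    (h3 : ∀ x ≥ x₀, C * x ^ (β - 2) ≤ f₂ x) :
    ∃ k > (0 : ℝ), ∀ p q : ℝ, 0 ≤ q → q ≤ p → 2 * x₀ ≤ p →
      k * p ^ (β - 2) * (p - q) ^ 2 ≤ f p + f q - 2 * f ((p + q) / 2) := by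
  refine ⟨C * (2 : ℝ) ^ (-|β - 2|) / 8, by positivity, fun p q hq hqp hp => ?_⟩
  set b := (p + q) / 2 with hb
  have hp0 : 0 < p := by linarith
  have hbp : b ≤ p := by linarith
  have hbx : x₀ ≤ b := by linarith
  have hup := quadratic_le_of_second_deriv_ge (f := f) (f₁ := f₁) (f₂ := f₂)
    (k := C * ((2 : ℝ) ^ (-|β - 2|) * p ^ (β - 2))) hbp
    (fun x hx => h1 x (hbx.trans hx.1)) (fun x hx => h2 x (hbx.trans hx.1))
    (fun x hx => le_trans (by
      gcongr
      exact rpow_mul_le_of_mem_Icc one_le_two hp0 (by linarith [hx.1]) (by linarith [hx.2]))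
      (h3 x (hbx.trans hx.1)))
  have hlow : f b + f₁ b * (q - b) ≤ f q := by
    rcases eq_or_lt_of_le (show q ≤ b by linarith) with h | h
    · rw [← h]; simp
    · have := hconv.slope_le_of_hasDerivAt (mem_Ici.2 hq) (mem_Ici.2 (by linarith)) h (h1 b hbx)
      rw [slope_def_field, div_le_iff₀ (by linarith)] at this
      linarith
  have e1 : p - b = (p - q) / 2 := by rw [hb]; ring
  have e2 : q - b = -((p - q) / 2) := by rw [hb]; ring
  rw [e1] at hup
  rw [e2] at hlow
  nlinarith

lemma exists_slope_ge {β : ℝ} (hβ : 0 < β) {f : ℝ → ℝ} {C x₀ : ℝ} (hC : 0 < C)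
    (hx₀ : 1 ≤ x₀) (hconv : ConvexOn ℝ (Ici (0 : ℝ)) f)
    (h0 : ∀ x ≥ x₀, C * x ^ β ≤ f x) :
    ∃ M ≥ (1 : ℝ), ∀ b μ : ℝ, 0 ≤ μ → μ ≤ b → M ≤ b →
      C / 2 * b ^ (β - 1) * (b - μ) ≤ f b - f μ := by
  have ht : ∀ᶠ x : ℝ in atTop, f 0 ≤ C / 2 * x ^ β :=
    ((tendsto_rpow_atTop hβ).const_mul_atTop (half_pos hC)).eventually_ge_atTop (f 0)
  obtain ⟨M, hM⟩ := eventually_atTop.1 ht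
  refine ⟨max M x₀, hx₀.trans (le_max_right _ _), fun b μ hμ hμb hb => ?_⟩
  have hb0 : 0 < b := by linarith [le_max_right M x₀]
  have hfb := h0 b ((le_max_right _ _).trans hb)
  have hf0 := hM b ((le_max_left _ _).trans hb)
  have hc := hconv.2 (mem_Ici.2 le_rfl) (mem_Ici.2 hb0.le)
    (show 0 ≤ 1 - μ / b by rw [sub_nonneg, div_le_one hb0]; exact hμb)
    (show 0 ≤ μ / b by positivity) (by ring)
  simp only [smul_eq_mul, mul_zero, zero_add] at hc
  rw [div_mul_cancel₀ _ hb0.ne'] at hc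
  rw [Real.rpow_sub_one hb0.ne']
  have e : C / 2 * (b ^ β / b) * (b - μ) = C / 2 * b ^ β * (1 - μ / b) := by field_simp
  rw [e]
  have : 0 ≤ 1 - μ / b := by rw [sub_nonneg, div_le_one hb0]; exact hμb
  nlinarith

lemma exists_convexGap_norm_ge {β : ℝ} (hβ : 1 < β) {f f₁ f₂ : ℝ → ℝ} {C x₀ : ℝ} (hC : 0 < C)
    (hx₀ : 1 ≤ x₀) (hconv : ConvexOn ℝ (Ici (0 : ℝ)) f)
    (h : ∀ x ≥ x₀, C * x ^ β ≤ f x ∧ HasDerivAt f (f₁ x) x ∧ HasDerivAt f₁ (f₂ x) x ∧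
        C * x ^ (β - 2) ≤ f₂ x)
    (E : Type*) [NormedAddCommGroup E] [InnerProductSpace ℝ E] :
    ∃ k > (0 : ℝ), ∃ M₀ ≥ (1 : ℝ), ∀ x y : E, M₀ ≤ max ‖x‖ ‖y‖ →
      k * max ‖x‖ ‖y‖ ^ (β - 2) * ‖x - y‖ ^ 2 ≤ convexGap (fun v => f ‖v‖) x y := by
  obtain ⟨k, hk, hrad⟩ := exists_radial_gap hC hx₀ hconv (fun x hx => (h x hx).2.1)
    (fun x hx => (h x hx).2.2.1) (fun x hx => (h x hx).2.2.2)
  obtain ⟨M₁, hM₁, hslope⟩ := exists_slope_ge (by linarith) hC hx₀ hconv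
    (fun x hx => (h x hx).1)
  set k₂ := C / 4 * (2 : ℝ) ^ (-|β - 1|) / 2 with hk₂
  have hk₂0 : 0 < k₂ := by positivity
  refine ⟨min k k₂, lt_min hk hk₂0, max (2 * x₀) (2 * M₁),
    le_trans (by linarith) (le_max_left _ _), ?_⟩
  have main : ∀ x y : E, ‖y‖ ≤ ‖x‖ → max (2 * x₀) (2 * M₁) ≤ ‖x‖ →
      min k k₂ * ‖x‖ ^ (β - 2) * ‖x - y‖ ^ 2 ≤ convexGap (fun v => f ‖v‖) x y := by
    intro x y hyx hM
    have hx1 : 2 * x₀ ≤ ‖x‖ := (le_max_left _ _).trans hM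
    have hx2 : 2 * M₁ ≤ ‖x‖ := (le_max_right _ _).trans hM
    have hx0 : 0 < ‖x‖ := by linarith
    have hr := hrad ‖x‖ ‖y‖ (norm_nonneg _) hyx hx1
    set b := (‖x‖ + ‖y‖) / 2 with hb
    set μ := ‖(1 / 2 : ℝ) • (x + y)‖ with hμ
    have hy0 := norm_nonneg y
    have hμ' : μ = ‖x + y‖ / 2 := by
      rw [hμ, norm_smul]; norm_num; ring
    have hμb : μ ≤ b := by rw [hμ', hb]; linarith [norm_add_le x y]
    have hbx : b ≤ ‖x‖ := by linarith
    have hs := hslope b μ (norm_nonneg _) hμb (by linarith)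
    have hbpow := rpow_mul_le_of_mem_Icc (β := β - 1) (b := b) one_le_two hx0 (by linarith)
      (by linarith)
    have hsq : b ^ 2 - μ ^ 2 = (‖x - y‖ ^ 2 - (‖x‖ - ‖y‖) ^ 2) / 4 := by
      rw [hμ', hb, div_pow ‖x + y‖, norm_add_sq_real, norm_sub_sq_real]; ring
    have hμ0 : 0 ≤ μ := norm_nonneg _
    have hdiff : ‖x - y‖ ^ 2 - (‖x‖ - ‖y‖) ^ 2 ≤ 8 * ‖x‖ * (b - μ) := by
      have : b ^ 2 - μ ^ 2 ≤ 2 * ‖x‖ * (b - μ) := by nlinarith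
      linarith
    have hrev : 0 ≤ ‖x - y‖ ^ 2 - (‖x‖ - ‖y‖) ^ 2 := by
      have : 0 ≤ b ^ 2 - μ ^ 2 := by nlinarith
      linarith
    set P := ‖x‖ ^ (β - 2) with hP
    have hP0 : 0 ≤ P := by positivity
    have hP1 : ‖x‖ ^ (β - 1) = P * ‖x‖ := by
      rw [hP, ← Real.rpow_add_one hx0.ne']; congr 1; ring
    rw [hP1] at hbpow
    have htan : k₂ * P * (‖x - y‖ ^ 2 - (‖x‖ - ‖y‖) ^ 2) ≤ 2 * (f b - f μ) := by
      calc k₂ * P * (‖x - y‖ ^ 2 - (‖x‖ - ‖y‖) ^ 2) ≤ k₂ * P * (8 * ‖x‖ * (b - μ)) := by gcongr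
        _ = 2 * (C / 2 * ((2 : ℝ) ^ (-|β - 1|) * (P * ‖x‖)) * (b - μ)) := by rw [hk₂]; ring
        _ ≤ 2 * (C / 2 * b ^ (β - 1) * (b - μ)) := by
            gcongr
        _ ≤ _ := by linarith
    have a1 : min k k₂ * P * (‖x‖ - ‖y‖) ^ 2 ≤ k * P * (‖x‖ - ‖y‖) ^ 2 := by
      gcongr; exact min_le_left _ _
    have a2 : min k k₂ * P * (‖x - y‖ ^ 2 - (‖x‖ - ‖y‖) ^ 2)
        ≤ k₂ * P * (‖x - y‖ ^ 2 - (‖x‖ - ‖y‖) ^ 2) := by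
      gcongr; exact min_le_right _ _
    simp only [convexGap]
    rw [← hμ]
    nlinarith
  intro x y hM
  rcases le_total ‖y‖ ‖x‖ with hxy | hxy
  · rw [max_eq_left hxy] at hM ⊢
    exact main x y hxy hM
  · rw [max_eq_right hxy] at hM ⊢
    rw [norm_sub_rev, convexGap_comm]
    exact main y x hxy hM

lemma exists_affine_le_convexGap {E : Type*} [NormedAddCommGroup E] [NormedSpace ℝ E]
    {Γ : E → E → ℝ} {β k M₀ : ℝ} (hβ : 1 < β) (hk : 0 < k) (hΓ0 : ∀ x y, 0 ≤ Γ x y)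
    (hΓ : ∀ x y : E, M₀ ≤ max ‖x‖ ‖y‖ →
      k * max ‖x‖ ‖y‖ ^ (β - 2) * ‖x - y‖ ^ 2 ≤ Γ x y) :
    ∃ k' > (0 : ℝ), ∀ a x y : E, 64 * M₀ ≤ ‖a‖ → 0 < ‖a‖ →
      k' * max ‖x‖ ‖a‖ ^ (β - 2) *
        (2 * (‖x - a‖ / 8) * ‖x - y‖ - (‖x - a‖ / 8) ^ 2) ≤ Γ x y := by
  refine ⟨k * (64 : ℝ) ^ (-|β - 2|), by positivity, fun a x y ha ha0 => ?_⟩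
  set R := max ‖x‖ ‖a‖ with hR
  set M := max ‖x‖ ‖y‖ with hM
  set T := ‖x - a‖ with hT
  set θ := T / 8 with hθ
  set r := ‖x - y‖ with hr
  have hR0 : 0 < R := ha0.trans_le (le_max_right _ _)
  have hxR : ‖x‖ ≤ R := le_max_left _ _
  have haR : ‖a‖ ≤ R := le_max_right _ _
  have hxM : ‖x‖ ≤ M := le_max_left _ _
  have hyM : ‖y‖ ≤ M := le_max_right _ _
  have hT0 : 0 ≤ T := norm_nonneg _
  have hr0 : 0 ≤ r := norm_nonneg _
  have hTR : T ≤ 2 * R := by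
    have := norm_sub_le x a
    linarith
  have hrM : r ≤ 2 * M := by
    have := norm_sub_le x y
    linarith
  have hone : (64 : ℝ) ^ (-|β - 2|) ≤ 1 :=
    Real.rpow_le_one_of_one_le_of_nonpos (by norm_num) (by simp)
  have hP0 : 0 < R ^ (β - 2) := by positivity
  rcases le_or_gt (2 * θ * r - θ ^ 2) 0 with hneg | hpos
  · exact (mul_nonpos_of_nonneg_of_nonpos (by positivity) hneg).trans (hΓ0 x y)
  have hrθ : T / 16 < r := by
    by_contra! hcon
    nlinarith
  have hMR : R / 64 ≤ M := by
    rcases le_or_gt (R / 64) ‖x‖ with h | h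
    · exact h.trans hxM
    · have hRa : R = ‖a‖ := by
        rcases max_choice ‖x‖ ‖a‖ with h' | h'
        · rw [← hR] at h'; linarith
        · exact h'
      have : ‖a‖ - ‖x‖ ≤ T := by
        rw [hT, norm_sub_rev]; exact norm_sub_norm_le a x
      linarith
  have hM0 : M₀ ≤ M := by linarith
  have hMpos : 0 < M := by linarith
  have hgap := hΓ x y hM0
  refine le_trans ?_ hgap
  rcases le_or_gt M (64 * R) with h4 | h4
  · have hp := rpow_mul_le_of_mem_Icc (β := β - 2) (by norm_num) hR0 hMR h4
    calc k * (64 : ℝ) ^ (-|β - 2|) * R ^ (β - 2) * (2 * θ * r - θ ^ 2)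
        ≤ k * (64 : ℝ) ^ (-|β - 2|) * R ^ (β - 2) * r ^ 2 := by
          gcongr
          nlinarith [sq_nonneg (r - θ)]
      _ = k * ((64 : ℝ) ^ (-|β - 2|) * R ^ (β - 2)) * r ^ 2 := by ring
      _ ≤ k * M ^ (β - 2) * r ^ 2 := by gcongr
  · have hMy : M = ‖y‖ := by
      rcases max_choice ‖x‖ ‖y‖ with h' | h'
      · rw [← hM] at h'; linarith
      · exact h'
    have hrM' : M / 2 ≤ r := by
      have : ‖y‖ - ‖x‖ ≤ r := by
        rw [hr, norm_sub_rev]; exact norm_sub_norm_le y x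
      linarith
    have hpow : R ^ (β - 2) * R ≤ M ^ (β - 2) * M := by
      rw [← Real.rpow_add_one hR0.ne', ← Real.rpow_add_one hMpos.ne']
      exact Real.rpow_le_rpow hR0.le (by linarith) (by linarith)
    calc k * (64 : ℝ) ^ (-|β - 2|) * R ^ (β - 2) * (2 * θ * r - θ ^ 2)
        ≤ k * 1 * R ^ (β - 2) * (R / 2 * r) := by
          gcongr
          nlinarith [sq_nonneg θ]
      _ = k * (R ^ (β - 2) * R) * (r / 2) := by ring
      _ ≤ k * (M ^ (β - 2) * M) * (r / 2) := by gcongr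
      _ = k * M ^ (β - 2) * (M / 2 * r) := by ring
      _ ≤ k * M ^ (β - 2) * r ^ 2 := by
          gcongr
          nlinarith

lemma exists_sum_gap_ge {E : Type*} [NormedAddCommGroup E] [NormedSpace ℝ E]
    {Γ : E → E → ℝ} {β k M₀ c : ℝ} (hβ : 1 < β) (hk : 0 < k) (hM₀ : 1 ≤ M₀) (hc : c ≤ 1)
    (hΓ0 : ∀ x y, 0 ≤ Γ x y)
    (hΓ : ∀ x y : E, M₀ ≤ max ‖x‖ ‖y‖ →
      k * max ‖x‖ ‖y‖ ^ (β - 2) * ‖x - y‖ ^ 2 ≤ Γ x y) :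
    ∃ k' > (0 : ℝ), ∀ a x : E, 64 * M₀ ≤ ‖a‖ → ‖a‖ ^ c ≤ ‖x - a‖ →
      ∀ (ι : Type) [Fintype ι] (Y : ι → E), ∑ i, Y i = (Fintype.card ι : ℝ) • a →
        Fintype.card ι * (k' * max ‖x - a‖ ‖a‖ ^ (β - 2 + 2 * c)) ≤ ∑ i, Γ x (Y i) := by
  obtain ⟨k₁, hk₁, haff⟩ := exists_affine_le_convexGap hβ hk hΓ0 hΓ
  refine ⟨k₁ * (2 : ℝ) ^ (-|β - 2|) / 8, by positivity, fun a x ha hxa ι _ Y hY => ?_⟩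
  have ha0 : 0 < ‖a‖ := by linarith
  set N : ℝ := (Fintype.card ι : ℝ) with hN
  set R := max ‖x‖ ‖a‖ with hR
  set T := ‖x - a‖ with hT
  set S := max T ‖a‖ with hS
  have hN0 : 0 ≤ N := Nat.cast_nonneg _
  have hS0 : 0 < S := ha0.trans_le (le_max_right _ _)
  have hR0 : 0 < R := ha0.trans_le (le_max_right _ _)
  have hT0 : 0 ≤ T := norm_nonneg _
  have hsumr : N * T ≤ ∑ i, ‖x - Y i‖ := by
    have : ∑ i, (x - Y i) = N • (x - a) := by
      rw [Finset.sum_sub_distrib, hY, Finset.sum_const, Finset.card_univ,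
        ← Nat.cast_smul_eq_nsmul ℝ, hN, ← smul_sub]
    calc N * T = ‖∑ i, (x - Y i)‖ := by
          rw [this, norm_smul, Real.norm_of_nonneg hN0]
      _ ≤ _ := norm_sum_le _ _
  have hsum : N * (k₁ * R ^ (β - 2) * (T ^ 2 / 8)) ≤ ∑ i, Γ x (Y i) := by
    calc N * (k₁ * R ^ (β - 2) * (T ^ 2 / 8))
        ≤ k₁ * R ^ (β - 2) * (2 * (T / 8) * (N * T) - N * (T / 8) ^ 2) := by
          have : 0 ≤ N * (k₁ * R ^ (β - 2)) * T ^ 2 := by positivity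
          nlinarith
      _ ≤ k₁ * R ^ (β - 2) * (2 * (T / 8) * (∑ i, ‖x - Y i‖) - N * (T / 8) ^ 2) := by
          gcongr
      _ = ∑ i, k₁ * R ^ (β - 2) * (2 * (T / 8) * ‖x - Y i‖ - (T / 8) ^ 2) := by
          rw [← Finset.mul_sum, Finset.sum_sub_distrib, ← Finset.mul_sum, Finset.sum_const,
            Finset.card_univ, nsmul_eq_mul]
      _ ≤ _ := Finset.sum_le_sum fun i _ => haff a x (Y i) ha ha0
  refine le_trans ?_ hsum
  have hxR : ‖x‖ ≤ R := le_max_left _ _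
  have haR : ‖a‖ ≤ R := le_max_right _ _
  have hTS : T ≤ S := le_max_left _ _
  have haS : ‖a‖ ≤ S := le_max_right _ _
  have hSR : S ≤ 2 * R := max_le (by have := norm_sub_le x a; linarith) (by linarith)
  have hRS : R ≤ 2 * S := by
    refine max_le ?_ (by linarith)
    have : ‖x‖ ≤ T + ‖a‖ := by simpa using norm_add_le (x - a) a
    linarith
  have hp := rpow_mul_le_of_mem_Icc (β := β - 2) one_le_two hS0 (by linarith) hRS
  have hTc : S ^ (2 * c) ≤ T ^ 2 := by
    have hTpos : 0 < T := (Real.rpow_pos_of_pos ha0 c).trans_le hxa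
    rcases le_total T ‖a‖ with h | h
    · rw [hS, max_eq_right h, mul_comm, Real.rpow_mul ha0.le, Real.rpow_two]
      have := Real.rpow_nonneg ha0.le c
      gcongr
    · rw [hS, max_eq_left h, ← Real.rpow_two]
      exact Real.rpow_le_rpow_of_exponent_le (by linarith) (by linarith)
  rw [Real.rpow_add hS0]
  calc N * (k₁ * (2 : ℝ) ^ (-|β - 2|) / 8 * (S ^ (β - 2) * S ^ (2 * c)))
      = N * (k₁ * ((2 : ℝ) ^ (-|β - 2|) * S ^ (β - 2)) * (S ^ (2 * c) / 8)) := by ring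
    _ ≤ N * (k₁ * R ^ (β - 2) * (T ^ 2 / 8)) := by gcongr

lemma eventually_rpow_add_log_le {γ ω A B k : ℝ} (hγ : γ < ω) (hω : 0 < ω) (hk : 0 < k) :
    ∀ᶠ S : ℝ in atTop, S ^ γ + A + B * Real.log S ≤ k * S ^ ω := by
  have h1 : (fun S : ℝ => S ^ γ) =o[atTop] fun S : ℝ => S ^ ω := by
    refine (Asymptotics.isLittleO_iff_tendsto' ?_).2 ?_
    · filter_upwards [eventually_gt_atTop 0] with S hS h
      exact absurd h (Real.rpow_pos_of_pos hS ω).ne'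
    · refine (tendsto_rpow_neg_atTop (sub_pos.2 hγ)).congr' ?_
      filter_upwards [eventually_gt_atTop 0] with S hS
      rw [neg_sub, Real.rpow_sub hS]
  have h2 : (fun _ : ℝ => A) =o[atTop] fun S : ℝ => S ^ ω :=
    Asymptotics.isLittleO_const_left.2
      (Or.inr (tendsto_norm_atTop_atTop.comp (tendsto_rpow_atTop hω)))
  have h3 : (fun S : ℝ => B * Real.log S) =o[atTop] fun S : ℝ => S ^ ω :=
    (isLittleO_log_rpow_atTop hω).const_mul_left B
  filter_upwards [((h1.add h2).add h3).bound hk, eventually_ge_atTop 0] with S hS hS0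
  rw [Real.norm_of_nonneg (Real.rpow_nonneg hS0 ω)] at hS
  exact (le_abs_self _).trans hS

lemma exists_rpow_le_avg_exp_gap {E : Type*} [NormedAddCommGroup E] [NormedSpace ℝ E]
    {Γ : E → E → ℝ} {β k M₀ c κ γ B : ℝ} (hβ : 1 < β) (hk : 0 < k) (hM₀ : 1 ≤ M₀) (hc : c ≤ 1)
    (hκ : 0 < κ) (hγ : 0 < γ) (hγω : γ < β - 2 + 2 * c) (hB : 0 < B)
    (hΓ0 : ∀ x y, 0 ≤ Γ x y)
    (hΓ : ∀ x y : E, M₀ ≤ max ‖x‖ ‖y‖ →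
      k * max ‖x‖ ‖y‖ ^ (β - 2) * ‖x - y‖ ^ 2 ≤ Γ x y) :
    ∃ K > (0 : ℝ), ∀ a x : E, K ≤ ‖a‖ → ‖a‖ ^ c ≤ ‖x - a‖ →
      ∀ (ι : Type) [Fintype ι] [Nonempty ι] (Y : ι → E),
        ∑ i, Y i = (Fintype.card ι : ℝ) • a →
        ‖x - a‖ ^ κ ≤ Real.exp (-‖a‖ ^ γ) * B⁻¹ *
          ((Fintype.card ι : ℝ)⁻¹ * ∑ i, Real.exp (1 / 2 * Γ x (Y i))) := by
  obtain ⟨k', hk', hsum⟩ := exists_sum_gap_ge hβ hk hM₀ hc hΓ0 hΓ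
  obtain ⟨K, hK⟩ := eventually_atTop.1 (eventually_rpow_add_log_le (A := Real.log B) (B := κ)
    hγω (hγ.trans hγω) (half_pos hk'))
  refine ⟨max K (64 * M₀), lt_of_lt_of_le (by linarith) (le_max_right _ _),
    fun a x ha hxa ι _ _ Y hY => ?_⟩
  have ha1 : 64 * M₀ ≤ ‖a‖ := (le_max_right _ _).trans ha
  have ha0 : 0 < ‖a‖ := by linarith
  have hs := hsum a x ha1 hxa ι Y hY
  set N : ℝ := (Fintype.card ι : ℝ) with hN
  have hN0 : 0 < N := by rw [hN]; exact_mod_cast Fintype.card_pos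
  set T := ‖x - a‖ with hT
  set S := max T ‖a‖ with hS
  have haS : ‖a‖ ≤ S := le_max_right _ _
  have hTS : T ≤ S := le_max_left _ _
  have hS0 : 0 < S := ha0.trans_le haS
  have hasy := hK S (((le_max_left _ _).trans ha).trans haS)
  have hjensen : Real.exp (∑ i, N⁻¹ * (1 / 2 * Γ x (Y i)))
      ≤ N⁻¹ * ∑ i, Real.exp (1 / 2 * Γ x (Y i)) := by
    have := convexOn_exp.map_sum_le (t := Finset.univ) (w := fun _ : ι => N⁻¹)
      (p := fun i => 1 / 2 * Γ x (Y i)) (fun _ _ => by positivity)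
      (by rw [Finset.sum_const, Finset.card_univ, nsmul_eq_mul, ← hN, mul_inv_cancel₀ hN0.ne'])
      (fun _ _ => mem_univ _)
    simpa only [smul_eq_mul, ← Finset.mul_sum] using this
  have hexp : k' / 2 * S ^ (β - 2 + 2 * c) ≤ ∑ i, N⁻¹ * (1 / 2 * Γ x (Y i)) := by
    rw [← Finset.mul_sum, ← Finset.mul_sum, ← div_eq_inv_mul, le_div_iff₀ hN0]
    linarith
  have hTκ : T ^ κ ≤ Real.exp (κ * Real.log S) := by
    rw [mul_comm, ← Real.rpow_def_of_pos hS0]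
    exact Real.rpow_le_rpow (norm_nonneg _) hTS hκ.le
  have hγS : ‖a‖ ^ γ ≤ S ^ γ := Real.rpow_le_rpow ha0.le haS hγ.le
  calc T ^ κ ≤ Real.exp (κ * Real.log S) := hTκ
    _ ≤ Real.exp (-‖a‖ ^ γ + -Real.log B + ∑ i, N⁻¹ * (1 / 2 * Γ x (Y i))) :=
        Real.exp_le_exp.2 (by linarith)
    _ = Real.exp (-‖a‖ ^ γ) * B⁻¹ * Real.exp (∑ i, N⁻¹ * (1 / 2 * Γ x (Y i))) := by
        rw [Real.exp_add, Real.exp_add, Real.exp_neg (Real.log B), Real.exp_log hB]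
    _ ≤ _ := by gcongr

lemma sum_comp_update {ι X M : Type*} [Fintype ι] [DecidableEq ι] [AddCommMonoid M]
    (g : X → M) (x : ι → X) (i : ι) (t : X) :
    ∑ j, g (Function.update x i t j) = g t + ∑ j ∈ Finset.univ.erase i, g (x j) := by
  rw [← Finset.add_sum_erase _ _ (Finset.mem_univ i), Function.update_self]
  congr 1
  exact Finset.sum_congr rfl fun j hj => by rw [Function.update_of_ne (Finset.ne_of_mem_erase hj)]

lemma convexGap_nonneg {E : Type*} [AddCommGroup E] [Module ℝ E] {F : E → ℝ}
    (hF : ConvexOn ℝ univ F) (x y : E) : 0 ≤ convexGap F x y := by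
  have h := hF.2 (mem_univ x) (mem_univ y) (show (0 : ℝ) ≤ 1 / 2 by norm_num)
    (show (0 : ℝ) ≤ 1 / 2 by norm_num) (by norm_num)
  rw [← smul_add] at h
  simp only [convexGap, smul_eq_mul] at h ⊢
  linarith

lemma ConvexOn.add_le_sub_convexGap {E : Type*} [AddCommGroup E] [Module ℝ E] {F : E → ℝ}
    (hF : ConvexOn ℝ univ F) (t s : E) :
    F ((1 / 2 : ℝ) • t + (1 / 4 : ℝ) • s) + F (s - ((1 / 2 : ℝ) • t + (1 / 4 : ℝ) • s))
      ≤ F t + F (s - t) - 1 / 2 * convexGap F t (s - t) := by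
  have h2 : (0 : ℝ) ≤ 1 / 2 := by norm_num
  have e1 : (1 / 2 : ℝ) • t + (1 / 4 : ℝ) • s
      = (1 / 2 : ℝ) • t + (1 / 2 : ℝ) • ((1 / 2 : ℝ) • (t + (s - t))) := by module
  have e2 : s - ((1 / 2 : ℝ) • t + (1 / 4 : ℝ) • s)
      = (1 / 2 : ℝ) • (s - t) + (1 / 2 : ℝ) • ((1 / 2 : ℝ) • (t + (s - t))) := by module
  have a1 := hF.2 (mem_univ t) (mem_univ ((1 / 2 : ℝ) • (t + (s - t)))) h2 h2 (by norm_num)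
  have a2 := hF.2 (mem_univ (s - t)) (mem_univ ((1 / 2 : ℝ) • (t + (s - t)))) h2 h2 (by norm_num)
  rw [e2, e1]
  simp only [convexGap, smul_eq_mul] at a1 a2 ⊢
  linarith

lemma lintegral_comp_smul_add {E : Type*} [NormedAddCommGroup E] [NormedSpace ℝ E]
    [MeasurableSpace E] [BorelSpace E] [FiniteDimensional ℝ E] (μ : Measure E)
    [μ.IsAddHaarMeasure] {g : E → ℝ≥0∞} (hg : Measurable g) {r : ℝ} (hr : r ≠ 0) (v : E) :
    ∫⁻ t, g (r • t + v) ∂μ = ENNReal.ofReal |(r ^ Module.finrank ℝ E)⁻¹| * ∫⁻ t, g t ∂μ := by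
  have hmap : ∫⁻ t, g (r • t + v) ∂μ = ∫⁻ t, g (t + v) ∂(Measure.map (fun x => r • x) μ) :=
    (lintegral_map (hg.comp (measurable_add_const v)) (measurable_const_smul r)).symm
  rw [hmap, Measure.map_addHaar_smul μ hr, lintegral_smul_measure, smul_eq_mul,
    lintegral_add_right_eq_self g v]

/-- The points `y i` together with the last point making the total sum equal to `z`. -/
def completion {ι E : Type*} [Fintype ι] [AddCommGroup E] (z : E) (y : ι → E) : Option ι → E :=
  fun o => o.elim (z - ∑ i, y i) y

lemma sum_completion {ι E : Type*} [Fintype ι] [AddCommGroup E] (z : E) (y : ι → E) :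
    ∑ o, completion z y o = z := by
  rw [Fintype.sum_option]
  simp [completion]

/-- The unnormalised density of `y` conditionally on the total sum being `z`. -/
def bridgeDensity {ι E : Type*} [Fintype ι] [AddCommGroup E] (F : E → ℝ) (z : E) (y : ι → E) :
    ℝ :=
  Real.exp (-(∑ i, F (y i)) - F (z - ∑ i, y i))

lemma sub_sum_update {ι E : Type*} [Fintype ι] [DecidableEq ι] [AddCommGroup E]
    (z : E) (x : ι → E) (i : ι) (t : E) :
    z - ∑ j, Function.update x i t j = (z - ∑ j ∈ Finset.univ.erase i, x j) - t := by
  rw [sum_comp_update (fun v => v)]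
  abel

lemma bridgeDensity_update {ι E : Type*} [Fintype ι] [DecidableEq ι] [AddCommGroup E]
    (F : E → ℝ) (z : E) (x : ι → E) (i : ι) (t : E) :
    bridgeDensity F z (Function.update x i t) =
      Real.exp (-(∑ j ∈ Finset.univ.erase i, F (x j)) -
        (F t + F ((z - ∑ j ∈ Finset.univ.erase i, x j) - t))) := by
  rw [bridgeDensity, sub_sum_update, sum_comp_update F]
  congr 1
  ring

lemma measurable_bridgeDensity {ι E : Type*} [Fintype ι] [NormedAddCommGroup E] [NormedSpace ℝ E]
    [MeasurableSpace E] [BorelSpace E] [FiniteDimensional ℝ E] {F : E → ℝ} (hF : Measurable F) (z : E) :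
    Measurable (bridgeDensity F z : (ι → E) → ℝ) := by
  unfold bridgeDensity
  fun_prop

lemma measurable_convexGap {ι E : Type*} [NormedAddCommGroup E] [NormedSpace ℝ E]
    [MeasurableSpace E] [BorelSpace E] [FiniteDimensional ℝ E] {F : E → ℝ} (hF : Measurable F) {g h : (ι → E) → E}
    (hg : Measurable g) (hh : Measurable h) :
    Measurable fun y => convexGap F (g y) (h y) := by
  unfold convexGap
  fun_prop

section Bridge

variable {ι E : Type*} [Fintype ι] [DecidableEq ι] [NormedAddCommGroup E] [NormedSpace ℝ E]
  [MeasurableSpace E] [BorelSpace E] [FiniteDimensional ℝ E]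
  (μ : Measure E) [μ.IsAddHaarMeasure]

lemma lintegral_exp_gap_last_le {F : E → ℝ} (hF : Measurable F) (hconv : ConvexOn ℝ univ F)
    (z : E) (i : ι) :
    ∫⁻ y : ι → E, ENNReal.ofReal (Real.exp (1 / 2 * convexGap F (y i) (z - ∑ j, y j)) *
        bridgeDensity F z y) ∂Measure.pi (fun _ => μ)
      ≤ ENNReal.ofReal (2 ^ Module.finrank ℝ E) *
        ∫⁻ y : ι → E, ENNReal.ofReal (bridgeDensity F z y) ∂Measure.pi (fun _ => μ) := by
  have hW := measurable_bridgeDensity (ι := ι) hF z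
  rw [← lintegral_const_mul _ hW.ennreal_ofReal]
  refine lintegral_le_of_lmarginal_le {i} ?_ (hW.ennreal_ofReal.const_mul _) ?_
  · exact (((measurable_convexGap hF (measurable_pi_apply i)
      (measurable_const.sub (by fun_prop))).const_mul _).exp.mul hW).ennreal_ofReal
  rw [lmarginal_singleton, lmarginal_singleton]
  intro x
  set s := z - ∑ j ∈ Finset.univ.erase i, x j with hs
  have hmeas : Measurable fun t => ENNReal.ofReal (bridgeDensity F z (Function.update x i t)) :=
    hW.ennreal_ofReal.comp (measurable_update x)
  have hscale := lintegral_comp_smul_add μ hmeas (r := 1 / 2) (by norm_num) ((1 / 4 : ℝ) • s)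
  have hc : |((1 / 2 : ℝ) ^ Module.finrank ℝ E)⁻¹| = 2 ^ Module.finrank ℝ E := by
    rw [abs_of_nonneg (by positivity), ← inv_pow]; norm_num
  rw [hc] at hscale
  simp only
  rw [lintegral_const_mul _ hmeas, ← hscale]
  refine lintegral_mono fun t => ENNReal.ofReal_le_ofReal ?_
  rw [bridgeDensity_update, bridgeDensity_update, sub_sum_update, Function.update_self, ← hs,
    ← Real.exp_add]
  apply Real.exp_le_exp.2
  have := hconv.add_le_sub_convexGap t s
  linarith

lemma lintegral_exp_gap_eq_last {F : E → ℝ} (hF : Measurable F) (z : E) {i j : ι} (hij : i ≠ j) :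
    ∫⁻ y : ι → E, ENNReal.ofReal (Real.exp (1 / 2 * convexGap F (y i) (y j)) *
        bridgeDensity F z y) ∂Measure.pi (fun _ => μ)
      = ∫⁻ y : ι → E, ENNReal.ofReal (Real.exp (1 / 2 * convexGap F (y i) (z - ∑ l, y l)) *
        bridgeDensity F z y) ∂Measure.pi (fun _ => μ) := by
  have hW := measurable_bridgeDensity (ι := ι) hF z
  refine lintegral_eq_of_lmarginal_eq {j} ?_ ?_ ?_
  · exact (((measurable_convexGap hF (measurable_pi_apply i)
      (measurable_pi_apply j)).const_mul _).exp.mul hW).ennreal_ofReal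
  · exact (((measurable_convexGap hF (measurable_pi_apply i)
      (measurable_const.sub (by fun_prop))).const_mul _).exp.mul hW).ennreal_ofReal
  rw [lmarginal_singleton, lmarginal_singleton]
  funext x
  rw [← lintegral_sub_left_eq_self _ (z - ∑ l ∈ Finset.univ.erase j, x l)]
  refine lintegral_congr fun t => ?_
  rw [bridgeDensity_update, bridgeDensity_update, sub_sum_update, Function.update_self,
    Function.update_of_ne hij, Function.update_of_ne hij, sub_sub_cancel, add_comm (F t)]

lemma lintegral_exp_gap_le {F : E → ℝ} (hF : Measurable F) (hconv : ConvexOn ℝ univ F)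
    (z : E) (i : ι) (o : Option ι) :
    ∫⁻ y : ι → E, ENNReal.ofReal (Real.exp (1 / 2 * convexGap F (y i) (completion z y o)) *
        bridgeDensity F z y) ∂Measure.pi (fun _ => μ)
      ≤ ENNReal.ofReal (2 ^ Module.finrank ℝ E) *
        ∫⁻ y : ι → E, ENNReal.ofReal (bridgeDensity F z y) ∂Measure.pi (fun _ => μ) := by
  have hlast := lintegral_exp_gap_last_le μ hF hconv z i
  cases o with
  | none => exact hlast
  | some j =>
    rcases eq_or_ne i j with rfl | hij
    · refine le_trans (le_of_eq ?_) (le_mul_of_one_le_left (zero_le) ?_)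
      · refine lintegral_congr fun y => ?_
        have : convexGap F (y i) (completion z y (some i)) = 0 := by
          have e : (1 / 2 : ℝ) • (y i + y i) = y i := by module
          simp only [convexGap, completion, Option.elim, e]
          ring
        rw [this]; simp
      · rw [ENNReal.one_le_ofReal]
        exact one_le_pow₀ one_le_two
    · exact (lintegral_exp_gap_eq_last μ hF z hij).trans_le hlast

lemma lintegral_avg_exp_gap_le {F : E → ℝ} (hF : Measurable F) (hconv : ConvexOn ℝ univ F)
    (z : E) (i : ι) :
    ∫⁻ y : ι → E, ENNReal.ofReal (((Fintype.card (Option ι) : ℝ)⁻¹ *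
        ∑ o, Real.exp (1 / 2 * convexGap F (y i) (completion z y o))) *
        bridgeDensity F z y) ∂Measure.pi (fun _ => μ)
      ≤ ENNReal.ofReal (2 ^ Module.finrank ℝ E) *
        ∫⁻ y : ι → E, ENNReal.ofReal (bridgeDensity F z y) ∂Measure.pi (fun _ => μ) := by
  have hW := measurable_bridgeDensity (ι := ι) hF z
  have hN : (0 : ℝ) < Fintype.card (Option ι) := by exact_mod_cast Fintype.card_pos
  have hcomp : ∀ o : Option ι, Measurable fun y : ι → E => completion z y o := by
    rintro (_ | j)
    · exact measurable_const.sub (by fun_prop)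
    · exact measurable_pi_apply j
  have hterm : ∀ o : Option ι, Measurable fun y : ι → E => ENNReal.ofReal
      (Real.exp (1 / 2 * convexGap F (y i) (completion z y o)) * bridgeDensity F z y) :=
    fun o => (((measurable_convexGap hF (measurable_pi_apply i) (hcomp o)).const_mul _).exp.mul
      hW).ennreal_ofReal
  have hsplit : ∀ y : ι → E, ENNReal.ofReal (((Fintype.card (Option ι) : ℝ)⁻¹ *
        ∑ o, Real.exp (1 / 2 * convexGap F (y i) (completion z y o))) * bridgeDensity F z y)
      = ENNReal.ofReal (Fintype.card (Option ι) : ℝ)⁻¹ * ∑ o, ENNReal.ofReal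
        (Real.exp (1 / 2 * convexGap F (y i) (completion z y o)) * bridgeDensity F z y) := by
    intro y
    rw [mul_assoc, ENNReal.ofReal_mul (by positivity), Finset.sum_mul,
      ENNReal.ofReal_sum_of_nonneg]
    intro o _
    exact mul_nonneg (Real.exp_pos _).le (Real.exp_pos _).le
  simp_rw [hsplit]
  rw [lintegral_const_mul _ (Finset.measurable_sum _ fun o _ => hterm o),
    lintegral_finsetSum _ fun o _ => hterm o]
  calc _ ≤ ENNReal.ofReal (Fintype.card (Option ι) : ℝ)⁻¹ * ∑ _o : Option ι,
        (ENNReal.ofReal (2 ^ Module.finrank ℝ E) *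
        ∫⁻ y : ι → E, ENNReal.ofReal (bridgeDensity F z y) ∂Measure.pi (fun _ => μ)) := by
        gcongr with o
        exact lintegral_exp_gap_le μ hF hconv z i o
    _ = _ := by
        rw [Finset.sum_const, Finset.card_univ, nsmul_eq_mul, ← mul_assoc,
          ENNReal.ofReal_inv_of_pos hN, ENNReal.ofReal_natCast, ENNReal.inv_mul_cancel, one_mul]
        · exact_mod_cast Fintype.card_ne_zero
        · exact ENNReal.natCast_ne_top _

end Bridge

lemma integrable_bridgeDensity {ι E : Type*} [Fintype ι] [NormedAddCommGroup E]
    [NormedSpace ℝ E] [FiniteDimensional ℝ E] [MeasurableSpace E] [BorelSpace E] {μ : Measure E}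
    [SigmaFinite μ] {F : E → ℝ} (hF : Measurable F) {L : ℝ} (hL : ∀ x, L ≤ F x)
    (hint : Integrable (fun x => Real.exp (-F x)) μ) (z : E) :
    Integrable (bridgeDensity F z : (ι → E) → ℝ) (Measure.pi fun _ => μ) := by
  have hprod : Integrable (fun y : ι → E => ∏ i, Real.exp (-F (y i))) (Measure.pi fun _ => μ) :=
    Integrable.fintype_prod fun _ => hint
  refine (hprod.const_mul (Real.exp (-L))).mono'
    (measurable_bridgeDensity hF z).aestronglyMeasurable (Eventually.of_forall fun y => ?_)
  rw [bridgeDensity, Real.norm_of_nonneg (Real.exp_pos _).le, ← Real.exp_sum,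
    Finset.sum_neg_distrib, ← Real.exp_add]
  apply Real.exp_le_exp.2
  linarith [hL (z - ∑ i, y i)]

lemma abs_integral_le_of_le_avg_exp_gap {ι E : Type*} [Fintype ι] [NormedAddCommGroup E]
    [NormedSpace ℝ E] [FiniteDimensional ℝ E] [MeasurableSpace E] [BorelSpace E] (μ : Measure E)
    [μ.IsAddHaarMeasure] {F : E → ℝ} (hF : Measurable F) (hconv : ConvexOn ℝ univ F) {z : E}
    (hint : Integrable (bridgeDensity F z : (ι → E) → ℝ) (Measure.pi fun _ => μ))
    (i : ι) {D : ℝ} (hD : 0 ≤ D) {g : (ι → E) → ℝ}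
    (hg : ∀ y, |g y| ≤ D * (2 ^ Module.finrank ℝ E)⁻¹ * ((Fintype.card (Option ι) : ℝ)⁻¹ *
        ∑ o, Real.exp (1 / 2 * convexGap F (y i) (completion z y o))) * bridgeDensity F z y) :
    |∫ y, g y ∂(Measure.pi fun _ => μ)| ≤
      D * ∫ y : ι → E, bridgeDensity F z y ∂(Measure.pi fun _ => μ) := by
  classical
  have hI0 : 0 ≤ ∫ y : ι → E, bridgeDensity F z y ∂(Measure.pi fun _ => μ) :=
    integral_nonneg fun y => (Real.exp_pos _).le
  have h1 := norm_integral_le_lintegral_norm (μ := Measure.pi fun _ : ι => μ) g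
  rw [Real.norm_eq_abs] at h1
  refine h1.trans (ENNReal.toReal_le_of_le_ofReal (mul_nonneg hD hI0) ?_)
  have hI : ENNReal.ofReal (∫ y : ι → E, bridgeDensity F z y ∂(Measure.pi fun _ => μ))
      = ∫⁻ y : ι → E, ENNReal.ofReal (bridgeDensity F z y) ∂Measure.pi (fun _ => μ) :=
    ofReal_integral_eq_lintegral_ofReal hint (Eventually.of_forall fun y => (Real.exp_pos _).le)
  have hc : ENNReal.ofReal (D * (2 ^ Module.finrank ℝ E)⁻¹) *
      ENNReal.ofReal (2 ^ Module.finrank ℝ E) = ENNReal.ofReal D := by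
    rw [← ENNReal.ofReal_mul (by positivity), inv_mul_cancel_right₀ (by positivity)]
  rw [ENNReal.ofReal_mul hD, hI, ← hc, mul_assoc]
  calc _ ≤ ∫⁻ y : ι → E, ENNReal.ofReal (D * (2 ^ Module.finrank ℝ E)⁻¹) *
        ENNReal.ofReal (((Fintype.card (Option ι) : ℝ)⁻¹ *
        ∑ o, Real.exp (1 / 2 * convexGap F (y i) (completion z y o))) *
        bridgeDensity F z y) ∂Measure.pi (fun _ => μ) := by
        refine lintegral_mono fun y => ?_
        rw [← ENNReal.ofReal_mul (by positivity), ← mul_assoc]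
        exact ENNReal.ofReal_le_ofReal (hg y)
    _ = ENNReal.ofReal (D * (2 ^ Module.finrank ℝ E)⁻¹) * ∫⁻ y : ι → E,
        ENNReal.ofReal (((Fintype.card (Option ι) : ℝ)⁻¹ *
        ∑ o, Real.exp (1 / 2 * convexGap F (y i) (completion z y o))) *
        bridgeDensity F z y) ∂Measure.pi (fun _ => μ) :=
        lintegral_const_mul' _ _ ENNReal.ofReal_ne_top
    _ ≤ _ := by
        gcongr
        exact lintegral_avg_exp_gap_le μ hF hconv z i

/-- Lemma 3.5: the contribution of configurations whose first jump `y₁` deviates from the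
mean `z/m` by more than `(‖z‖/m)^c`, weighted by a polynomially bounded function `h`, is
exponentially negligible relative to the full convolution integral. -/
theorem stmt16 {n : ℕ} (hn : 0 < n) {α : ℝ} (hα : 1 < α) {f : ℝ → ℝ}
    (hf : SmoothRegVary α f)
    (hconv : ConvexOn ℝ (Set.Ici (0 : ℝ)) f) (hmono : MonotoneOn f (Set.Ici (0 : ℝ)))
    (hnorm : ∫ z : EuclideanSpace ℝ (Fin n), Real.exp (-f ‖z‖) = 1)
    (κ : ℝ) (hκ : 0 < κ) (c : ℝ) (hc : c ∈ Set.Ioo (1 - α / 2) 1)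
    (γ : ℝ) (hγ : γ ∈ Set.Ioo (0 : ℝ) (2 * c + α - 2)) :
    ∃ K > (0 : ℝ), ∀ (m : ℕ) (hm : 2 ≤ m), ∀ z : EuclideanSpace ℝ (Fin n),
      K ≤ ‖z‖ / m → ∀ h : EuclideanSpace ℝ (Fin n) → ℝ, Measurable h →
      (∀ y : EuclideanSpace ℝ (Fin n), (‖z‖ / m) ^ c ≤ ‖y‖ →
        |h (y + (m : ℝ)⁻¹ • z)| ≤ ‖y‖ ^ κ) →
      |∫ y : Fin (m - 1) → EuclideanSpace ℝ (Fin n),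
          Set.indicator {y : Fin (m - 1) → EuclideanSpace ℝ (Fin n) |
              (‖z‖ / m) ^ c ≤ ‖y ⟨0, by omega⟩ - (m : ℝ)⁻¹ • z‖}
            (fun y => h (y ⟨0, by omega⟩) *
              Real.exp (-(∑ i, f ‖y i‖) - f ‖z - ∑ i, y i‖)) y|
        ≤ Real.exp (-(‖z‖ / m) ^ γ) *
          ∫ y : Fin (m - 1) → EuclideanSpace ℝ (Fin n),
            Real.exp (-(∑ i, f ‖y i‖) - f ‖z - ∑ i, y i‖) := by
  obtain ⟨hc1, hc2⟩ := hc
  obtain ⟨hγ0, hγ1⟩ := hγ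
  set V := EuclideanSpace ℝ (Fin n) with hV
  set F : V → ℝ := fun v => f ‖v‖ with hFdef
  have hFeq : F = (fun r : ℝ => f (max r 0)) ∘ norm := by
    funext v
    rw [hFdef, Function.comp_apply, max_eq_left (norm_nonneg v)]
  have hFmeas : Measurable F := by
    rw [hFeq]
    refine Measurable.comp (Monotone.measurable fun a b hab => ?_) measurable_norm
    exact hmono (mem_Ici.2 (le_max_right _ _)) (mem_Ici.2 (le_max_right _ _))
      (max_le_max_right 0 hab)
  have hFconv : ConvexOn ℝ univ F := by
    refine ⟨convex_univ, fun x _ y _ s t hs ht hst => ?_⟩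
    have h1 : ‖s • x + t • y‖ ≤ s * ‖x‖ + t * ‖y‖ := by
      refine (norm_add_le _ _).trans_eq ?_
      rw [norm_smul, norm_smul, Real.norm_of_nonneg hs, Real.norm_of_nonneg ht]
    exact (hmono (mem_Ici.2 (norm_nonneg _)) (mem_Ici.2 (by positivity)) h1).trans
      (hconv.2 (mem_Ici.2 (norm_nonneg x)) (mem_Ici.2 (norm_nonneg y)) hs ht hst)
  have hFlow : ∀ x, f 0 ≤ F x := fun x =>
    hmono self_mem_Ici (mem_Ici.2 (norm_nonneg x)) (norm_nonneg x)
  have hFint : Integrable (fun x => Real.exp (-F x)) := by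
    by_contra hcon
    have := integral_undef hcon
    rw [this] at hnorm
    exact zero_ne_one hnorm
  obtain ⟨β, hβ1, hβα⟩ := exists_between (max_lt hα (show γ + 2 - 2 * c < α by linarith))
  obtain ⟨hβ1, hβ2⟩ := max_lt_iff.1 hβ1
  obtain ⟨C, hC, x₀, hx₀, f₁, f₂, hreg⟩ := hf.exists_rpow_le hα hβα
  obtain ⟨k, hk, M₀, hM₀, hgap⟩ := exists_convexGap_norm_ge hβ1 hC hx₀ hconv hreg V
  obtain ⟨K, hK, hmain⟩ := exists_rpow_le_avg_exp_gap (κ := κ) (γ := γ)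
    (B := 2 ^ Module.finrank ℝ V) hβ1 hk hM₀ hc2.le hκ hγ0
    (by linarith) (by positivity) (convexGap_nonneg hFconv) hgap
  refine ⟨K, hK, fun m hm z hz h _ hh => ?_⟩
  obtain ⟨j, rfl⟩ : ∃ j, m = j + 2 := ⟨m - 2, by omega⟩
  have hm0 : (0 : ℝ) < ((j + 2 : ℕ) : ℝ) := by positivity
  set a : V := (((j + 2 : ℕ) : ℝ))⁻¹ • z with ha
  have hnorma : ‖a‖ = ‖z‖ / ((j + 2 : ℕ) : ℝ) := by
    rw [ha, norm_smul, norm_inv, Real.norm_of_nonneg hm0.le, inv_mul_eq_div]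
  rw [← hnorma] at hz hh ⊢
  have hcard : (Fintype.card (Option (Fin (j + 1))) : ℝ) = ((j + 2 : ℕ) : ℝ) := by
    rw [Fintype.card_option, Fintype.card_fin]
  refine abs_integral_le_of_le_avg_exp_gap (ι := Fin (j + 1)) volume hFmeas hFconv
    (integrable_bridgeDensity hFmeas hFlow hFint z) 0 (Real.exp_pos _).le fun y => ?_
  have hW0 : 0 < bridgeDensity F z y := Real.exp_pos _
  by_cases hy : ‖a‖ ^ c ≤ ‖y 0 - a‖
  · have hsum : ∑ o, completion z y o = (Fintype.card (Option (Fin (j + 1))) : ℝ) • a := by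
      rw [sum_completion, hcard, ha, smul_inv_smul₀ hm0.ne']
    have hb := hmain a (y 0) hz hy _ (completion z y) hsum
    have hh' := hh (y 0 - a) hy
    rw [sub_add_cancel] at hh'
    have hind := Set.indicator_of_mem (s := {y : Fin (j + 1) → V | ‖a‖ ^ c ≤ ‖y 0 - a‖}) hy
      (fun y => h (y 0) * bridgeDensity F z y)
    refine (congrArg abs hind).trans_le ?_
    simp only [abs_mul, abs_of_pos hW0]
    exact mul_le_mul_of_nonneg_right (hh'.trans hb) hW0.le
  · have hind := Set.indicator_of_notMem (s := {y : Fin (j + 1) → V | ‖a‖ ^ c ≤ ‖y 0 - a‖}) hy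
      (fun y => h (y 0) * bridgeDensity F z y)
    refine (congrArg abs hind).trans_le ?_
    rw [abs_zero]
    have := Real.exp_pos (-‖a‖ ^ γ)
    positivity
end
end

section
/- Let ℓ ∈ ℕ and let θ : ℝ^ℓ → [0,∞) be a measurable function with θ(k·y) ≥ k·θ(y) for all k ≥ 1 and all y ∈ ℝ^ℓ. Then for all 0 < z₀ ≤ z: λ_ℓ({y ∈ ℝ^ℓ : θ(y) < z}) ≤ (z/z₀)^ℓ · λ_ℓ({y ∈ ℝ^ℓ : θ(y) < z₀}), where λ_ℓ denotes Lebesgue measure on ℝ^ℓ. -/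
open MeasureTheory

noncomputable section

/-- The sublevel-set scaling bound (3.57): if `θ : ℝ^ℓ → [0,∞)` satisfies
`θ(k y) ≥ k θ(y)` for `k ≥ 1`, then `λ_ℓ{θ < z} ≤ (z/z₀)^ℓ λ_ℓ{θ < z₀}` for `0 < z₀ ≤ z`. -/
theorem stmt17 (ℓ : ℕ) (θ : (Fin ℓ → ℝ) → ℝ) (hmeas : Measurable θ)
    (hθ0 : ∀ y, 0 ≤ θ y)
    (hθ : ∀ k : ℝ, 1 ≤ k → ∀ y : Fin ℓ → ℝ, k * θ y ≤ θ (k • y))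
    (z₀ z : ℝ) (h0 : 0 < z₀) (hz : z₀ ≤ z) :
    volume {y : Fin ℓ → ℝ | θ y < z}
      ≤ ENNReal.ofReal ((z / z₀) ^ ℓ) * volume {y : Fin ℓ → ℝ | θ y < z₀} := by
  have hk : 1 ≤ z / z₀ := (one_le_div h0).2 hz
  have hkpos : 0 < z / z₀ := one_pos.trans_le hk
  open scoped Pointwise in
  have hsub : {y : Fin ℓ → ℝ | θ y < z} ⊆ (z / z₀) • {y : Fin ℓ → ℝ | θ y < z₀} := by
    intro y hy
    rw [Set.mem_smul_set_iff_inv_smul_mem₀ hkpos.ne']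
    have h := hθ (z / z₀) hk ((z / z₀)⁻¹ • y)
    rw [smul_inv_smul₀ hkpos.ne'] at h
    refine lt_of_mul_lt_mul_left ?_ hkpos.le
    rw [div_mul_cancel₀ z h0.ne']
    exact h.trans_lt hy
  refine (measure_mono hsub).trans_eq ?_
  rw [Measure.addHaar_smul_of_nonneg volume hkpos.le, Module.finrank_fin_fun]
end
end

section
/- Let n ∈ ℕ, β ∈ (0,2), and let ν be a measure on ℝⁿ with ν({0}) = 0 and ∫ min(1,‖y‖²) ν(dy) < ∞. Assume there exist r₀ > 0 and k > 0 such that for all r ∈ (0,r₀) and all x ∈ ℝⁿ with ‖x‖ = 1: ∫_{{‖y‖<r}} ⟨x,y⟩² ν(dy) ≥ k·r^β. Then for every λ ∈ ℝⁿ with ‖λ‖ ≥ 1/r₀: ∫_{ℝⁿ} (1 − cos⟨λ,y⟩) ν(dy) ≥ (k/3)·‖λ‖^{2−β}. -/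
open MeasureTheory Real
open scoped RealInnerProductSpace ENNReal

noncomputable section

theorem one_third_sq_le_one_sub_cos {t : ℝ} (ht : |t| ≤ 1) :
    t ^ 2 / 3 ≤ 1 - Real.cos t := by
  have h := (abs_le.mp (Real.cos_bound ht)).2
  have h4 : |t| ^ 4 ≤ t ^ 2 := by
    rw [← sq_abs t]
    exact pow_le_pow_of_le_one (abs_nonneg t) ht (by norm_num)
  linarith [sq_nonneg t]

theorem integrable_one_sub_cos_inner {E : Type*} [NormedAddCommGroup E] [InnerProductSpace ℝ E]
    [MeasurableSpace E] [BorelSpace E] [SecondCountableTopology E] {ν : Measure E}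
    (hν : ∫⁻ y, ENNReal.ofReal (min 1 (‖y‖ ^ 2)) ∂ν < ⊤) (l : E) :
    Integrable (fun y => 1 - Real.cos ⟪l, y⟫) ν := by
  have hmin : Integrable (fun y : E => min 1 (‖y‖ ^ 2)) ν := by
    refine ⟨(by fun_prop : Continuous fun y : E => min 1 (‖y‖ ^ 2)).aestronglyMeasurable, ?_⟩
    rwa [hasFiniteIntegral_iff_ofReal (.of_forall fun y => by positivity)]
  refine (hmin.const_mul (2 + ‖l‖ ^ 2)).mono'
    (by fun_prop : Continuous fun y : E => 1 - Real.cos ⟪l, y⟫).aestronglyMeasurable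
    (.of_forall fun y => ?_)
  rw [Real.norm_of_nonneg (sub_nonneg.mpr (Real.cos_le_one _))]
  rcases min_cases 1 (‖y‖ ^ 2) with ⟨h, -⟩ | ⟨h, -⟩ <;> rw [h]
  · linarith [Real.neg_one_le_cos ⟪l, y⟫, sq_nonneg ‖l‖]
  · have hsq : ⟪l, y⟫ ^ 2 ≤ ‖l‖ ^ 2 * ‖y‖ ^ 2 := by
      rw [← mul_pow, ← sq_abs]
      exact pow_le_pow_left₀ (abs_nonneg _) (abs_real_inner_le_norm l y) 2
    nlinarith [Real.one_sub_sq_div_two_le_cos (x := ⟪l, y⟫), sq_nonneg ‖y‖, sq_nonneg ⟪l, y⟫]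

theorem setIntegral_inner_sq_le_integral_one_sub_cos {E : Type*} [NormedAddCommGroup E]
    [InnerProductSpace ℝ E] [MeasurableSpace E] [BorelSpace E] [SecondCountableTopology E]
    {ν : Measure E} (hν : ∫⁻ y, ENNReal.ofReal (min 1 (‖y‖ ^ 2)) ∂ν < ⊤) {l : E} {r : ℝ}
    (hr : ‖l‖ * r ≤ 1) :
    ∫ y in {y : E | ‖y‖ < r}, ⟪l, y⟫ ^ 2 / 3 ∂ν ≤ ∫ y, (1 - Real.cos ⟪l, y⟫) ∂ν := by
  have hint := integrable_one_sub_cos_inner hν l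
  refine le_trans (integral_mono_of_nonneg (.of_forall fun y => by positivity)
    hint.integrableOn ?_) (setIntegral_le_integral hint
      (.of_forall fun y => sub_nonneg.mpr (Real.cos_le_one _)))
  refine ae_restrict_of_forall_mem (measurableSet_lt measurable_norm measurable_const)
    fun y (hy : ‖y‖ < r) => one_third_sq_le_one_sub_cos ?_
  calc |⟪l, y⟫| ≤ ‖l‖ * ‖y‖ := abs_real_inner_le_norm l y
    _ ≤ ‖l‖ * r := by gcongr
    _ ≤ 1 := hr

/-- Estimate (A.2): the uniform multidimensional Orey condition on a Lévy measure `ν`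
implies the lower bound `∫ (1 - cos⟨λ,y⟩) ν(dy) ≥ (k/3) ‖λ‖^{2-β}` for `‖λ‖ ≥ 1/r₀`. -/
theorem stmt18 {n : ℕ} (hn : 0 < n) (ν : Measure (EuclideanSpace ℝ (Fin n)))
    (hν0 : ν {0} = 0)
    (hν2 : ∫⁻ y, ENNReal.ofReal (min 1 (‖y‖ ^ 2)) ∂ν < ⊤)
    (β : ℝ) (hβ : β ∈ Set.Ioo (0 : ℝ) 2)
    (r₀ k : ℝ) (hr₀ : 0 < r₀) (hk : 0 < k)
    (hOrey : ∀ r ∈ Set.Ioo (0 : ℝ) r₀, ∀ x : EuclideanSpace ℝ (Fin n), ‖x‖ = 1 →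
      k * r ^ β ≤ ∫ y in {y : EuclideanSpace ℝ (Fin n) | ‖y‖ < r}, ⟪x, y⟫ ^ 2 ∂ν) :
    ∀ l : EuclideanSpace ℝ (Fin n), 1 / r₀ ≤ ‖l‖ →
      k / 3 * ‖l‖ ^ (2 - β) ≤ ∫ y, (1 - Real.cos ⟪l, y⟫) ∂ν := by
  intro l hl
  have hL : 0 < ‖l‖ := (by positivity : 0 < 1 / r₀).trans_le hl
  have hinv : ‖l‖⁻¹ ≤ r₀ := inv_le_of_inv_le₀ hr₀ (by rwa [← one_div])
  have key : ∀ r ∈ Set.Ioo 0 ‖l‖⁻¹,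
      k / 3 * ‖l‖ ^ 2 * r ^ β ≤ ∫ y, (1 - Real.cos ⟪l, y⟫) ∂ν := by
    intro r hr
    have hlr : ‖l‖ * r ≤ 1 := by
      rw [← mul_inv_cancel₀ hL.ne']
      exact mul_le_mul_of_nonneg_left hr.2.le hL.le
    refine le_trans ?_ (setIntegral_inner_sq_le_integral_one_sub_cos hν2 hlr)
    have hO := hOrey r ⟨hr.1, hr.2.trans_le hinv⟩ (‖l‖⁻¹ • l)
      (by rw [norm_smul, norm_inv, norm_norm, inv_mul_cancel₀ hL.ne'])
    simp only [real_inner_smul_left, mul_pow, integral_const_mul] at hO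
    rw [integral_div]
    have hO' := mul_le_mul_of_nonneg_left hO (sq_nonneg ‖l‖)
    rw [← mul_assoc (‖l‖ ^ 2) (‖l‖⁻¹ ^ 2), ← mul_pow, mul_inv_cancel₀ hL.ne', one_pow,
      one_mul] at hO'
    linarith
  have hlim : Filter.Tendsto (fun r : ℝ => k / 3 * ‖l‖ ^ 2 * r ^ β) (nhdsWithin ‖l‖⁻¹ (Set.Iio ‖l‖⁻¹))
      (nhds (k / 3 * ‖l‖ ^ 2 * ‖l‖⁻¹ ^ β)) :=
    ((Real.continuousAt_rpow_const _ _ (Or.inr hβ.1.le)).tendsto.mono_left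
      nhdsWithin_le_nhds).const_mul _
  have hle := le_of_tendsto hlim
    (Filter.mem_of_superset (Ioo_mem_nhdsLT (inv_pos.mpr hL)) key)
  rwa [Real.inv_rpow hL.le, mul_assoc, ← div_eq_mul_inv, ← Real.rpow_natCast,
    ← Real.rpow_sub hL] at hle
end
end
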